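/- arXiv:1611.09002 — 2 statements merged into one kernel-verified Lean document; each statement's English description precedes it below -/
import Mathlib

section
/- Let G be a simple graph with maximum degree Δ, and let M be a matching of G whose edges are pairwise at distance at least 9. Then any precolouring of M from the palette {1, …, Δ + 1} extends to a proper (Δ + 1)-edge-colouring of G. -/
namespace SimpleGraph

variable {V : Type}

/-- Two distinct edges (as unordered pairs) share an endpoint. -/
def EdgeAdj (e f : Sym2 V) : Prop :=
  e ≠ f ∧ ∃ v, v ∈ e ∧ v ∈ f

/-- The distance between edges `e` and `f` is at least `d`: every path between
an endpoint of `e` and an endpoint of `f` has length at least `d`. -/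
def EdgeDistGe (G : SimpleGraph V) (e f : Sym2 V) (d : ℕ) : Prop :=
  ∀ u v, u ∈ e → v ∈ f → ∀ p : G.Walk u v, d ≤ p.length

/-- A matching of `G`: pairwise non-adjacent edges of `G`. -/
def IsMatchingSet (G : SimpleGraph V) (M : Set (Sym2 V)) : Prop :=
  M ⊆ G.edgeSet ∧ ∀ e ∈ M, ∀ f ∈ M, e ≠ f → ¬ EdgeAdj e f

/-- A proper edge-colouring of `G` (off a deleted set `D`) with colours from
`{1, …, k}`. -/
def IsProperEC (G : SimpleGraph V) (D : Set (Sym2 V)) (k : ℕ) (c : Sym2 V → ℕ) : Prop :=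
  (∀ e ∈ G.edgeSet, e ∉ D → c e ∈ Finset.Icc 1 k) ∧
    ∀ e ∈ G.edgeSet, ∀ f ∈ G.edgeSet, e ∉ D → f ∉ D → EdgeAdj e f → c e ≠ c f

end SimpleGraph

open SimpleGraph

namespace SimpleGraph

/-- The colours of `K` are used properly by `c`; edges coloured outside `K` are unrestricted. -/
def ProperOn {V : Type} (G : SimpleGraph V) (K : Finset ℕ) (c : Sym2 V → ℕ) : Prop :=
  ∀ a b d, G.Adj a b → G.Adj a d → b ≠ d → c s(a, b) ∈ K → c s(a, b) ≠ c s(a, d)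

/-- No edge at `v` has colour `β`. -/
def Misses {V : Type} (G : SimpleGraph V) (c : Sym2 V → ℕ) (v : V) (β : ℕ) : Prop :=
  ∀ w, G.Adj v w → c s(v, w) ≠ β

/-- Passing from `c` to `c'` only recolours `e` within `K`, if at all. -/
def RecolouredWithin {V : Type} (K : Finset ℕ) (c c' : Sym2 V → ℕ) (e : Sym2 V) : Prop :=
  (c e ∈ K → c' e ∈ K) ∧ (c e ∉ K → c' e = c e)

/-- A Vizing fan `f 0, …, f n` around `x`. -/
structure IsFan {V : Type} (G : SimpleGraph V) (K : Finset ℕ) (c : Sym2 V → ℕ) (x : V) (n : ℕ)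
    (f : ℕ → V) : Prop where
  adj : ∀ i ≤ n, G.Adj x (f i)
  inj : ∀ i ≤ n, ∀ j ≤ n, f i = f j → i = j
  zero : c s(x, f 0) ∉ K
  mem : ∀ i < n, c s(x, f (i + 1)) ∈ K
  misses : ∀ i < n, G.Misses c (f i) (c s(x, f (i + 1)))

/-- Rotating the colours around `x` so that `xz` receives the colour of `xy`. -/
structure IsShift {V : Type} (G : SimpleGraph V) (K : Finset ℕ) (c c' : Sym2 V → ℕ) (x y z : V) :
    Prop where
  proper : G.ProperOn K c'
  off : ∀ a b, a ≠ x → b ≠ x → c' s(a, b) = c s(a, b)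
  last : c' s(x, z) = c s(x, y)
  first : y ≠ z → c' s(x, y) ∈ K
  rest : ∀ w, G.Adj x w → w ≠ y → w ≠ z → RecolouredWithin K c c' s(x, w)
  centre : ∀ α ∈ K, G.Misses c x α → G.Misses c' x α

/-- The edge `xy` can be given a colour of `K` by recolouring within `K`. -/
def Absorbable {V : Type} (G : SimpleGraph V) (K : Finset ℕ) (c : Sym2 V → ℕ) (x y : V) : Prop :=
  ∃ c', G.ProperOn K c' ∧ c' s(x, y) ∈ K ∧
    ∀ e ∈ G.edgeSet, e ≠ s(x, y) → RecolouredWithin K c c' e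

section Fans

variable {V : Type} {G : SimpleGraph V} {K : Finset ℕ} {c : Sym2 V → ℕ}

lemma ProperOn.modify {c' : Sym2 V → ℕ} {x : V} (h : G.ProperOn K c)
    (hoff : ∀ a b, a ≠ x → b ≠ x → c' s(a, b) = c s(a, b))
    (hx : ∀ b d, G.Adj x b → G.Adj x d → b ≠ d → c' s(x, b) ∈ K → c' s(x, b) ≠ c' s(x, d))
    (hw : ∀ w v, G.Adj x w → G.Adj w v → v ≠ x → c' s(x, w) ∈ K → c' s(x, w) ≠ c s(w, v)) :
    G.ProperOn K c' := by
  intro a b d hab had hbd hK heq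
  by_cases hax : a = x
  · subst hax
    exact hx b d hab had hbd hK heq
  by_cases hbx : b = x
  · subst hbx
    rw [Sym2.eq_swap (a := a) (b := b)] at hK heq
    exact hw a d hab.symm had hbd.symm hK (by rw [heq, hoff a d hax hbd.symm])
  by_cases hdx : d = x
  · subst hdx
    rw [Sym2.eq_swap (a := a) (b := d)] at heq
    exact hw a b had.symm hab hbd (heq ▸ hK) (by rw [← heq, hoff a b hax hbx])
  rw [hoff a b hax hbx] at hK heq
  rw [hoff a d hax hdx] at heq
  exact h a b d hab had hbd hK heq

lemma IsShift.refl (h : G.ProperOn K c) (x y : V) : G.IsShift K c c x y y where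
  proper := h
  off _ _ _ _ := rfl
  last := rfl
  first h := absurd rfl h
  rest _ _ _ _ := ⟨id, fun _ => rfl⟩
  centre _ _ h := h

lemma IsShift.step [DecidableEq V] {x y z : V} (h : G.ProperOn K c) (hxy : G.Adj x y)
    (hxz : G.Adj x z)
    (hyz : y ≠ z) (hy : c s(x, y) ∉ K) (hz : c s(x, z) ∈ K) (hm : G.Misses c y (c s(x, z))) :
    G.IsShift K c (fun e => c (Equiv.swap s(x, y) s(x, z) e)) x y z := by
  have hat : ∀ w, Equiv.swap s(x, y) s(x, z) s(x, w) = s(x, Equiv.swap y z w) := by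
    intro w
    by_cases hwy : w = y
    · rw [hwy, Equiv.swap_apply_left, Equiv.swap_apply_left]
    by_cases hwz : w = z
    · rw [hwz, Equiv.swap_apply_right, Equiv.swap_apply_right]
    rw [Equiv.swap_apply_of_ne_of_ne hwy hwz, Equiv.swap_apply_of_ne_of_ne
      (mt Sym2.congr_right.1 hwy) (mt Sym2.congr_right.1 hwz)]
  have hoff : ∀ a b, a ≠ x → b ≠ x → Equiv.swap s(x, y) s(x, z) s(a, b) = s(a, b) := by
    intro a b ha hb
    apply Equiv.swap_apply_of_ne_of_ne <;> simp [ha, hb]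
  have hadj : ∀ w, G.Adj x w → G.Adj x (Equiv.swap y z w) := by
    intro w hw
    simp only [Equiv.swap_apply_def]
    split_ifs <;> assumption
  refine ⟨h.modify (x := x) ?_ ?_ ?_, ?_, ?_, ?_, ?_, ?_⟩
  · intro a b ha hb
    rw [hoff a b ha hb]
  · intro b d hb hd hbd hK
    simp only [hat] at hK ⊢
    exact h _ _ _ (hadj b hb) (hadj d hd) ((Equiv.swap y z).injective.ne hbd) hK
  · intro w v hw hv hvx hK heq
    simp only [hat] at hK heq
    by_cases hwy : w = y
    · subst hwy
      rw [Equiv.swap_apply_left] at heq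
      exact hm v hv heq.symm
    by_cases hwz : w = z
    · subst hwz
      rw [Equiv.swap_apply_right] at hK
      exact hy hK
    rw [Equiv.swap_apply_of_ne_of_ne hwy hwz, Sym2.eq_swap] at heq hK
    exact h w x v hw.symm hv hvx.symm hK heq
  · intro a b ha hb
    rw [hoff a b ha hb]
  · simp
  · intro _
    rw [Equiv.swap_apply_left]
    exact hz
  · intro w hw hwy hwz
    simp only [RecolouredWithin, hat, Equiv.swap_apply_of_ne_of_ne hwy hwz]
    exact ⟨id, fun _ => trivial⟩
  · intro α _ hα w hw
    simp only [hat]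
    exact hα _ (hadj w hw)

lemma IsFan.tail [DecidableEq V] {x : V} {n : ℕ} {f : ℕ → V} (hf : G.IsFan K c x (n + 1) f) :
    G.IsFan K (fun e => c (Equiv.swap s(x, f 0) s(x, f 1) e)) x n (fun i => f (i + 1)) := by
  have hne : ∀ i ≤ n, f (i + 1) ≠ f 0 := fun i hi h => by
    have := hf.inj (i + 1) (by omega) 0 (by omega) h
    omega
  have hne' : ∀ i < n, f (i + 2) ≠ f 1 := fun i hi h => by
    have := hf.inj (i + 2) (by omega) 1 (by omega) h
    omega
  have hfx : ∀ i ≤ n + 1, f i ≠ x := fun i hi => (hf.adj i hi).ne'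
  have hcol : ∀ i < n, c (Equiv.swap s(x, f 0) s(x, f 1) s(x, f (i + 1 + 1)))
      = c s(x, f (i + 2)) := by
    intro i hi
    rw [Equiv.swap_apply_of_ne_of_ne]
    · exact mt Sym2.congr_right.1 (hne (i + 1) (by omega))
    · exact mt Sym2.congr_right.1 (hne' i hi)
  refine ⟨fun i hi => hf.adj _ (by omega), fun i hi j hj h => ?_, ?_, fun i hi => ?_,
    fun i hi => ?_⟩
  · have := hf.inj (i + 1) (by omega) (j + 1) (by omega) h
    omega
  · simpa using hf.zero
  · simp only [hcol i hi]
    exact hf.mem (i + 1) (by omega)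
  · simp only [hcol i hi]
    intro w hw
    by_cases h1 : s(f (i + 1), w) = s(x, f 1)
    · intro h
      simp only [h1, Equiv.swap_apply_right] at h
      exact hf.zero (h ▸ hf.mem (i + 1) (by omega))
    by_cases h0 : s(f (i + 1), w) = s(x, f 0)
    · rw [Sym2.eq_iff] at h0
      rcases h0 with h0 | h0
      · exact absurd h0.1 (hfx _ (by omega))
      · exact absurd h0.1 (hne i (by omega))
    simp only [Equiv.swap_apply_of_ne_of_ne h0 h1]
    exact hf.misses (i + 1) (by omega) w hw

lemma IsFan.exists_shift [DecidableEq V] (h : G.ProperOn K c) {x : V} {n : ℕ} {f : ℕ → V}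
    (hf : G.IsFan K c x n f) : ∃ c', G.IsShift K c c' x (f 0) (f n) := by
  induction n generalizing c f with
  | zero => exact ⟨c, IsShift.refl h _ _⟩
  | succ n ih =>
    have h01 : f 0 ≠ f 1 := fun h => by
      have := hf.inj 0 (by omega) 1 (by omega) h
      omega
    have h0n : f 0 ≠ f (n + 1) := fun h => by
      have := hf.inj 0 (by omega) (n + 1) (by omega) h
      omega
    have hs := IsShift.step h (hf.adj 0 (by omega)) (hf.adj 1 (by omega)) h01 hf.zero
      (hf.mem 0 (by omega)) (hf.misses 0 (by omega))
    obtain ⟨c', hc'⟩ := ih hs.proper hf.tail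
    have h0K : c' s(x, f 0) ∈ K := by
      refine (hc'.rest (f 0) (hf.adj 0 (by omega)) h01 h0n).1 ?_
      simpa using hf.mem 0 (by omega)
    refine ⟨c', hc'.proper, ?_, ?_, fun _ => h0K, ?_, ?_⟩
    · intro a b ha hb
      rw [hc'.off a b ha hb, hs.off a b ha hb]
    · rw [hc'.last, hs.last]
    · intro w hw hw0 hwn
      by_cases hw1 : w = f 1
      · subst hw1
        have hK := hf.mem 0 (by omega)
        exact ⟨fun _ => hc'.first hwn, fun h => absurd hK h⟩
      · have h1 := hs.rest w hw hw0 hw1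
        have h2 := hc'.rest w hw hw1 hwn
        refine ⟨fun h => h2.1 (h1.1 h), fun h => ?_⟩
        have h3 := h1.2 h
        rw [h2.2 (by rw [h3]; exact h), h3]
    · intro α hα hm
      exact hc'.centre α hα (hs.centre α hα hm)

lemma IsFan.absorbable [DecidableEq V] (h : G.ProperOn K c) {x : V} {n : ℕ} {f : ℕ → V}
    (hf : G.IsFan K c x n f) {α : ℕ} (hα : α ∈ K) (hx : G.Misses c x α)
    (hn : G.Misses c (f n) α) : G.Absorbable K c x (f 0) := by
  obtain ⟨c', hc'⟩ := hf.exists_shift h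
  have hxn := hf.adj n le_rfl
  have hoff : ∀ a b, a ≠ x → b ≠ x → Function.update c' s(x, f n) α s(a, b) = c' s(a, b) := by
    intro a b ha hb
    rw [Function.update_of_ne]
    simp [ha, hb]
  have hat : ∀ w, w ≠ f n → Function.update c' s(x, f n) α s(x, w) = c' s(x, w) := by
    intro w hw
    rw [Function.update_of_ne (mt Sym2.congr_right.1 hw)]
  refine ⟨Function.update c' s(x, f n) α, hc'.proper.modify hoff ?_ ?_, ?_, ?_⟩
  · intro b d hb hd hbd hK
    have hm := hc'.centre α hα hx
    by_cases hbn : b = f n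
    · subst hbn
      rw [hat d hbd.symm, Function.update_self]
      exact (hm d hd).symm
    by_cases hdn : d = f n
    · subst hdn
      rw [hat b hbd, Function.update_self]
      exact hm b hb
    rw [hat b hbn] at hK ⊢
    rw [hat d hdn]
    exact hc'.proper x b d hb hd hbd hK
  · intro w v hw hv hvx hK
    by_cases hwn : w = f n
    · subst hwn
      rw [Function.update_self, hc'.off _ _ hw.ne' hvx]
      exact (hn v hv).symm
    rw [hat w hwn] at hK ⊢
    rw [Sym2.eq_swap] at hK ⊢
    exact hc'.proper w x v hw.symm hv hvx.symm hK
  · by_cases h0 : f 0 = f n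
    · rw [h0, Function.update_self]
      exact hα
    · rw [hat _ h0]
      exact hc'.first h0
  · intro e he hne
    by_cases hen : e = s(x, f n)
    · subst hen
      rw [RecolouredWithin, Function.update_self]
      refine ⟨fun _ => hα, fun h' => ?_⟩
      rcases n with _ | n
      · exact absurd rfl hne
      · exact absurd (hf.mem n (by omega)) h'
    rw [RecolouredWithin, Function.update_of_ne hen]
    induction e with | _ a b =>
    rw [mem_edgeSet] at he
    by_cases hax : a = x
    · subst hax
      exact hc'.rest b he (fun h => hne (by rw [h])) (fun h => hen (by rw [h]))
    by_cases hbx : b = x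
    · subst hbx
      rw [Sym2.eq_swap] at hne hen ⊢
      exact hc'.rest a he.symm (fun h => hne (by rw [h])) (fun h => hen (by rw [h]))
    rw [hc'.off a b hax hbx]
    exact ⟨id, fun _ => rfl⟩

end Fans

end SimpleGraph

namespace SimpleGraph

/-- The subgraph of edges coloured `α` or `β`. -/
def kempeGraph {V : Type} (G : SimpleGraph V) (c : Sym2 V → ℕ) (α β : ℕ) : SimpleGraph V where
  Adj v w := G.Adj v w ∧ (c s(v, w) = α ∨ c s(v, w) = β)
  symm := ⟨fun v w h => ⟨h.1.symm, by rw [Sym2.eq_swap]; exact h.2⟩⟩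
  loopless := ⟨fun v h => G.loopless.irrefl v h.1⟩

/-- No edge coloured `α` or `β` leaves `S`. -/
def KempeClosed {V : Type} (G : SimpleGraph V) (c : Sym2 V → ℕ) (α β : ℕ) (S : Set V) : Prop :=
  ∀ a ∈ S, ∀ b, G.Adj a b → (c s(a, b) = α ∨ c s(a, b) = β) → b ∈ S

open Classical in
/-- Interchange `α` and `β` on the edges meeting `S`. -/
noncomputable def kempeSwap {V : Type} (c : Sym2 V → ℕ) (α β : ℕ) (S : Set V) : Sym2 V → ℕ :=
  fun e => if ∃ v ∈ S, v ∈ e then Equiv.swap α β (c e) else c e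

section Kempe

variable {V : Type} {G : SimpleGraph V} {K : Finset ℕ} {c : Sym2 V → ℕ} {α β : ℕ} {S : Set V}

lemma kempeSwap_of_mem {a b : V} (ha : a ∈ S) :
    kempeSwap c α β S s(a, b) = Equiv.swap α β (c s(a, b)) :=
  if_pos ⟨a, ha, Sym2.mem_mk_left a b⟩

lemma KempeClosed.kempeSwap_of_notMem (hS : G.KempeClosed c α β S) {a b : V} (hab : G.Adj a b)
    (ha : a ∉ S) : kempeSwap c α β S s(a, b) = c s(a, b) := by
  by_cases hb : b ∈ S
  · rw [Sym2.eq_swap, kempeSwap_of_mem hb]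
    have h : ¬ (c s(b, a) = α ∨ c s(b, a) = β) := fun h => ha (hS b hb a hab.symm h)
    push Not at h
    exact Equiv.swap_apply_of_ne_of_ne h.1 h.2
  · refine if_neg ?_
    rintro ⟨v, hv, hve⟩
    rcases Sym2.mem_iff.1 hve with rfl | rfl
    · exact ha hv
    · exact hb hv

lemma swap_mem_iff (hα : α ∈ K) (hβ : β ∈ K) (γ : ℕ) : Equiv.swap α β γ ∈ K ↔ γ ∈ K := by
  rw [Equiv.swap_apply_def]
  split_ifs with h1 h2
  · simp [h1, hα, hβ]
  · simp [h2, hα, hβ]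
  · rfl

lemma kempeSwap_recolouredWithin (hα : α ∈ K) (hβ : β ∈ K) (e : Sym2 V) :
    RecolouredWithin K c (kempeSwap c α β S) e := by
  rw [RecolouredWithin, kempeSwap]
  split_ifs
  · refine ⟨(swap_mem_iff hα hβ _).2, fun h => ?_⟩
    apply Equiv.swap_apply_of_ne_of_ne <;> rintro rfl <;> contradiction
  · exact ⟨id, fun _ => rfl⟩

lemma ProperOn.kempeSwap (h : G.ProperOn K c) (hα : α ∈ K) (hβ : β ∈ K)
    (hS : G.KempeClosed c α β S) : G.ProperOn K (kempeSwap c α β S) := by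
  intro a b d hab had hbd hK
  by_cases ha : a ∈ S
  · rw [kempeSwap_of_mem ha] at hK ⊢
    rw [kempeSwap_of_mem ha]
    exact (Equiv.swap α β).injective.ne (h a b d hab had hbd ((swap_mem_iff hα hβ _).1 hK))
  · rw [hS.kempeSwap_of_notMem hab ha] at hK ⊢
    rw [hS.kempeSwap_of_notMem had ha]
    exact h a b d hab had hbd hK

lemma Misses.kempeSwap {v : V} {γ : ℕ} (h : G.Misses c v γ) (hS : G.KempeClosed c α β S)
    (hv : v ∉ S ∨ (γ ≠ α ∧ γ ≠ β)) : G.Misses (kempeSwap c α β S) v γ := by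
  intro w hw
  by_cases hvS : v ∈ S
  · rw [kempeSwap_of_mem hvS, Ne, Equiv.swap_apply_eq_iff]
    obtain ⟨h1, h2⟩ := hv.resolve_left (not_not.2 hvS)
    rw [Equiv.swap_apply_of_ne_of_ne h1 h2]
    exact h w hw
  · rw [hS.kempeSwap_of_notMem hw hvS]
    exact h w hw

lemma Misses.kempeSwap_left {v : V} (h : G.Misses c v β) (hv : v ∈ S) :
    G.Misses (SimpleGraph.kempeSwap c α β S) v α := by
  intro w hw
  rw [kempeSwap_of_mem hv, Ne, Equiv.swap_apply_eq_iff, Equiv.swap_apply_left]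
  exact h w hw

lemma kempeClosed_reachable (v : V) :
    G.KempeClosed c α β {w | (G.kempeGraph c α β).Reachable v w} :=
  fun _ ha _ hab hc => Reachable.trans ha (Adj.reachable ⟨hab, hc⟩)

/-- A connected graph of maximum degree two has at most two vertices of degree at most one. -/
lemma not_reachable_of_three_degree_le_one [Fintype V] (H : SimpleGraph V) [DecidableRel H.Adj]
    (h2 : ∀ v, H.degree v ≤ 2) {x y z : V} (hxy : x ≠ y) (hxz : x ≠ z) (hyz : y ≠ z)
    (hx : H.degree x ≤ 1) (hy : H.degree y ≤ 1) (hz : H.degree z ≤ 1) (hrxy : H.Reachable x y) :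
    ¬ H.Reachable x z := by
  classical
  intro hrxz
  let C := H.connectedComponentMk x
  have hxC : x ∈ C := rfl
  have hyC : y ∈ C := ConnectedComponent.sound hrxy.symm
  have hzC : z ∈ C := ConnectedComponent.sound hrxz.symm
  have hdeg : ∀ w : C, C.toSimpleGraph.degree w ≤ H.degree w := fun w =>
    Copy.degree_le ⟨C.toSimpleGraph_hom, Subtype.val_injective⟩ w
  have hcard := C.connected_toSimpleGraph.card_vert_le_card_edgeSet_add_one
  rw [Nat.card_eq_fintype_card, Nat.card_eq_fintype_card, ← edgeFinset_card] at hcard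
  have hsum := C.toSimpleGraph.sum_degrees_eq_twice_card_edges
  let T : Finset C := {⟨x, hxC⟩, ⟨y, hyC⟩, ⟨z, hzC⟩}
  have hT : T.card = 3 := by
    apply Finset.card_eq_three.2
    exact ⟨_, _, _, by simpa using hxy, by simpa using hxz, by simpa using hyz, rfl⟩
  have hle : ∑ w : C, (C.toSimpleGraph.degree w + if w ∈ T then 1 else 0) ≤ ∑ _w : C, 2 := by
    apply Finset.sum_le_sum
    intro w _
    have := hdeg w
    split_ifs with hw
    · have : H.degree w ≤ 1 := by
        simp only [T, Finset.mem_insert, Finset.mem_singleton] at hw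
        rcases hw with rfl | rfl | rfl <;> assumption
      omega
    · have := h2 w
      omega
  rw [Finset.sum_add_distrib, hsum] at hle
  simp only [Finset.sum_ite_mem, Finset.univ_inter, Finset.sum_const, smul_eq_mul, hT,
    Finset.card_univ] at hle
  omega

/-- In a connected graph properly coloured with two colours, at most two vertices see at most one
colour. -/
lemma not_reachable_of_three_ends [Fintype V] (H : SimpleGraph V)
    (hH : ∀ v w, H.Adj v w → c s(v, w) = α ∨ c s(v, w) = β)
    (hp : ∀ a b d, H.Adj a b → H.Adj a d → c s(a, b) = c s(a, d) → b = d)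
    {x y z : V} (hxy : x ≠ y) (hxz : x ≠ z) (hyz : y ≠ z)
    (hx : ∃ γ, ∀ w, H.Adj x w → c s(x, w) = γ) (hy : ∃ γ, ∀ w, H.Adj y w → c s(y, w) = γ)
    (hz : ∃ γ, ∀ w, H.Adj z w → c s(z, w) = γ) (hrxy : H.Reachable x y) :
    ¬ H.Reachable x z := by
  classical
  have hdeg : ∀ (T : Finset ℕ) v, (∀ w, H.Adj v w → c s(v, w) ∈ T) → H.degree v ≤ T.card := by
    intro T v hT
    refine Finset.card_le_card_of_injOn (fun w => c s(v, w)) ?_ ?_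
    · intro w hw
      exact hT w (by simpa using hw)
    · intro w hw w' hw' h
      exact hp v w w' (by simpa using hw) (by simpa using hw') h
  have h1 : ∀ v, (∃ γ, ∀ w, H.Adj v w → c s(v, w) = γ) → H.degree v ≤ 1 := fun v ⟨γ, hγ⟩ =>
    hdeg {γ} v fun w hw => by simpa using hγ w hw
  refine not_reachable_of_three_degree_le_one H (fun v => ?_) hxy hxz hyz (h1 x hx) (h1 y hy)
    (h1 z hz) hrxy
  exact (hdeg {α, β} v fun w hw => by simpa using hH v w hw).trans Finset.card_le_two

lemma ends_of_misses {v : V} (h : G.Misses c v α ∨ G.Misses c v β) :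
    ∃ γ, ∀ w, (G.kempeGraph c α β).Adj v w → c s(v, w) = γ := by
  rcases h with h | h
  · exact ⟨β, fun w hw => hw.2.resolve_left (h w hw.1)⟩
  · exact ⟨α, fun w hw => hw.2.resolve_right (h w hw.1)⟩

lemma Absorbable.of_kempeSwap {x y : V} (hα : α ∈ K) (hβ : β ∈ K)
    (h : G.Absorbable K (SimpleGraph.kempeSwap c α β S) x y) : G.Absorbable K c x y := by
  obtain ⟨c', hp, hK, hc'⟩ := h
  refine ⟨c', hp, hK, fun e he hne => ?_⟩
  have h1 := kempeSwap_recolouredWithin (c := c) (S := S) hα hβ e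
  have h2 := hc' e he hne
  refine ⟨fun h => h2.1 (h1.1 h), fun h => ?_⟩
  have h3 := h1.2 h
  rw [h2.2 (by rw [h3]; exact h), h3]

lemma IsFan.kempeSwap {x : V} {n k : ℕ} {f : ℕ → V} (hf : G.IsFan K c x n f) (hk : k ≤ n)
    (hS : G.KempeClosed c α β S) (hxS : x ∉ S)
    (hm : ∀ i < k, f i ∉ S ∨ (c s(x, f (i + 1)) ≠ α ∧ c s(x, f (i + 1)) ≠ β)) :
    G.IsFan K (kempeSwap c α β S) x k f := by
  have hat : ∀ i ≤ n, SimpleGraph.kempeSwap c α β S s(x, f i) = c s(x, f i) := fun i hi =>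
    hS.kempeSwap_of_notMem (hf.adj i hi) hxS
  refine ⟨fun i hi => hf.adj i (by omega), fun i hi j hj => hf.inj i (by omega) j (by omega),
    ?_, fun i hi => ?_, fun i hi => ?_⟩
  · rw [hat 0 (by omega)]
    exact hf.zero
  · rw [hat (i + 1) (by omega)]
    exact hf.mem i (by omega)
  · rw [hat (i + 1) (by omega)]
    exact (hf.misses i (by omega)).kempeSwap hS (hm i hi)

lemma IsFan.absorbable_of_repeat [Fintype V] [DecidableEq V] (h : G.ProperOn K c) {x : V}
    {n j : ℕ} {f : ℕ → V} (hf : G.IsFan K c x n f) (hj : j < n) (hα : α ∈ K)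
    (hx : G.Misses c x α) (hn : G.Misses c (f n) (c s(x, f (j + 1)))) :
    G.Absorbable K c x (f 0) := by
  obtain ⟨β, hβ⟩ : ∃ β, c s(x, f (j + 1)) = β := ⟨_, rfl⟩
  have hβK : β ∈ K := hβ ▸ hf.mem j hj
  rw [hβ] at hn
  have hjβ : G.Misses c (f j) β := hβ ▸ hf.misses j hj
  have hne : ∀ i < n, i ≠ j → c s(x, f (i + 1)) ≠ α ∧ c s(x, f (i + 1)) ≠ β := by
    intro i hi hij
    refine ⟨hx _ (hf.adj (i + 1) (by omega)), hβ ▸ ?_⟩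
    refine h x _ _ (hf.adj (i + 1) (by omega)) (hf.adj (j + 1) (by omega)) (fun he => ?_)
      (hf.mem i hi)
    have := hf.inj (i + 1) (by omega) (j + 1) (by omega) he
    omega
  by_cases hr : (G.kempeGraph c α β).Reachable (f j) x
  · have hrn : ¬ (G.kempeGraph c α β).Reachable (f j) (f n) := by
      refine not_reachable_of_three_ends (G.kempeGraph c α β) (fun v w hvw => hvw.2)
        (fun a b d hab had he => ?_)
        (hf.adj j (by omega)).ne' (fun he => ?_) (hf.adj n le_rfl).ne
        (ends_of_misses (.inr hjβ)) (ends_of_misses (.inl hx)) (ends_of_misses (.inr hn)) hr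
      · by_contra hbd
        refine h a b d hab.1 had.1 hbd ?_ he
        rcases hab.2 with h' | h' <;> rw [h'] <;> assumption
      · have := hf.inj j (by omega) n le_rfl he
        omega
    have hS := kempeClosed_reachable (G := G) (c := c) (α := α) (β := β) (f n)
    have hxS : x ∉ {w | (G.kempeGraph c α β).Reachable (f n) w} :=
      fun hx' => hrn (hr.trans (Reachable.symm hx'))
    refine Absorbable.of_kempeSwap hα hβK (IsFan.absorbable (h.kempeSwap hα hβK hS)
      (hf.kempeSwap le_rfl hS hxS fun i hi => ?_) hα (hx.kempeSwap hS (.inl hxS))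
      (hn.kempeSwap_left (Reachable.refl _)))
    by_cases hij : i = j
    · subst hij
      exact .inl fun h' => hrn (Reachable.symm h')
    · exact .inr (hne i hi hij)
  · have hS := kempeClosed_reachable (G := G) (c := c) (α := α) (β := β) (f j)
    exact Absorbable.of_kempeSwap hα hβK (IsFan.absorbable (h.kempeSwap hα hβK hS)
      (hf.kempeSwap hj.le hS hr fun i hi => .inr (hne i (by omega) (by omega))) hα
      (hx.kempeSwap hS (.inl hr)) (hjβ.kempeSwap_left (Reachable.refl _)))

end Kempe

end SimpleGraph

namespace SimpleGraph

section VizingFan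

variable {V : Type} {G : SimpleGraph V} {K : Finset ℕ} {c : Sym2 V → ℕ}

lemma mem_of_forall_not_misses [Fintype V] [DecidableEq V] [DecidableRel G.Adj] {z : V}
    (hdeg : G.degree z ≤ K.card)
    (hz : ∀ α ∈ K, ¬ G.Misses c z α) {w : V} (hw : G.Adj z w) : c s(z, w) ∈ K := by
  by_contra hK
  have hsub : K ⊆ ((G.neighborFinset z).erase w).image (fun v => c s(z, v)) := by
    intro α hα
    have := hz α hα
    simp only [Misses] at this
    push Not at this
    obtain ⟨v, hv, hvα⟩ := this
    refine Finset.mem_image.2 ⟨v, Finset.mem_erase.2 ⟨?_, by simpa using hv⟩, hvα⟩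
    rintro rfl
    exact hK (hvα ▸ hα)
  have h1 := (Finset.card_le_card hsub).trans Finset.card_image_le
  rw [Finset.card_erase_of_mem (by simpa using hw), card_neighborFinset_eq_degree] at h1
  have := hw.degree_pos_left
  omega

lemma exists_misses [Fintype V] [DecidableEq V] [DecidableRel G.Adj] {x y : V}
    (hdeg : G.degree x ≤ K.card) (hxy : G.Adj x y) (hc : c s(x, y) ∉ K) :
    ∃ α ∈ K, G.Misses c x α := by
  by_contra! h
  exact hc (mem_of_forall_not_misses hdeg h hxy)

/-- Vizing's fan argument: either `xy` can be absorbed, or the colours around `x` can be rotated so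
that the colour of `xy` moves to an edge `xz` at which every colour of `K` appears. -/
lemma absorbable_or_exists_shift [Fintype V] [DecidableEq V] [DecidableRel G.Adj]
    (h : G.ProperOn K c) (hdeg : ∀ v, G.degree v ≤ K.card) {x y : V} (hxy : G.Adj x y)
    (hc : c s(x, y) ∉ K) :
    G.Absorbable K c x y ∨ ∃ z c', z ≠ y ∧ G.Adj x z ∧ (∀ α ∈ K, ¬ G.Misses c z α) ∧
      G.IsShift K c c' x y z := by
  by_contra! hcon
  obtain ⟨habs, hshift⟩ := hcon
  obtain ⟨α, hα, hxα⟩ := exists_misses (hdeg x) hxy hc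
  have hfan : ∀ n, ∃ f, G.IsFan K c x n f ∧ f 0 = y := by
    intro n
    induction n with
    | zero =>
      exact ⟨fun _ => y, ⟨fun _ _ => hxy, by intros; omega, hc, by intros; omega,
        by intros; omega⟩, rfl⟩
    | succ n ih =>
      obtain ⟨f, hf, hf0⟩ := ih
      obtain ⟨β, hβ, hnβ⟩ : ∃ β ∈ K, G.Misses c (f n) β := by
        by_cases hn : n = 0
        · subst hn
          rw [hf0]
          rw [Sym2.eq_swap] at hc
          exact exists_misses (hdeg y) hxy.symm hc
        · by_contra! hfull
          obtain ⟨c', hc'⟩ := hf.exists_shift h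
          rw [hf0] at hc'
          refine hshift (f n) c' (fun he => hn ?_) (hf.adj n le_rfl) hfull hc'
          exact hf.inj n le_rfl 0 (by omega) (he.trans hf0.symm)
      have hxβ : ¬ G.Misses c x β := fun hxβ => habs (hf0 ▸ hf.absorbable h hβ hxβ hnβ)
      simp only [Misses] at hxβ
      push Not at hxβ
      obtain ⟨z, hz, hzβ⟩ := hxβ
      have hnew : ∀ j ≤ n, f j ≠ z := by
        rintro (_ | i) hi rfl
        · exact hf.zero (hzβ ▸ hβ)
        · exact habs (hf0 ▸ hf.absorbable_of_repeat h (by omega : i < n) hα hxα (hzβ ▸ hnβ))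
      refine ⟨fun i => if i ≤ n then f i else z, ⟨fun i hi => ?_, fun i hi j hj he => ?_, ?_,
        fun i hi => ?_, fun i hi => ?_⟩, by simpa using hf0⟩
      · split_ifs with h'
        · exact hf.adj i h'
        · exact hz
      · split_ifs at he with h1 h2 h2
        · exact hf.inj i h1 j h2 he
        · exact absurd he (hnew i h1)
        · exact absurd he.symm (hnew j h2)
        · omega
      · simpa using hf.zero
      · split_ifs with h1
        · exact hf.mem i (by omega)
        · exact hzβ ▸ hβ
      · rw [if_pos (by omega : i ≤ n)]
        split_ifs with h1
        · exact hf.misses i (by omega)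
        · obtain rfl : i = n := by omega
          exact hzβ ▸ hnβ
  obtain ⟨f, hf, -⟩ := hfan (Fintype.card V)
  have := Fintype.card_le_of_injective (fun i : Fin (Fintype.card V + 1) => f i)
    (fun i j hij => Fin.ext (hf.inj i (by omega) j (by omega) hij))
  simp at this

end VizingFan

end SimpleGraph

namespace SimpleGraph

/-- The edges of colour `b`. -/
def colourClass {V : Type} (G : SimpleGraph V) (c : Sym2 V → ℕ) (b : ℕ) : Set (Sym2 V) :=
  {e ∈ G.edgeSet | c e = b}

/-- `c` uses the colours of `K` and `a` properly, all remaining edges have colour `b`, and the edges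
of `M` have colour `a`. -/
structure IsPartial {V : Type} (G : SimpleGraph V) (K : Finset ℕ) (a b : ℕ) (M : Set (Sym2 V))
    (c : Sym2 V → ℕ) : Prop where
  proper : G.ProperOn K c
  proper_singleton : G.ProperOn {a} c
  range : ∀ e ∈ G.edgeSet, c e ∈ K ∨ c e = a ∨ c e = b
  eq_on : ∀ e ∈ M, c e = a

/-- An `IsPartial` colouring with the fewest edges of colour `b`. -/
structure IsOptimal {V : Type} (G : SimpleGraph V) (K : Finset ℕ) (a b : ℕ) (M : Set (Sym2 V))
    (c : Sym2 V → ℕ) : Prop extends G.IsPartial K a b M c where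
  le : ∀ c', G.IsPartial K a b M c' → (G.colourClass c b).ncard ≤ (G.colourClass c' b).ncard

section Optimal

variable {V : Type} {G : SimpleGraph V} {K : Finset ℕ} {c c' : Sym2 V → ℕ} {a b : ℕ}
  {M : Set (Sym2 V)}

lemma RecolouredWithin.eq_iff {e : Sym2 V} (h : RecolouredWithin K c c' e) (ha : a ∉ K) :
    c' e = a ↔ c e = a := by
  by_cases hc : c e ∈ K
  · have := h.1 hc
    constructor <;> rintro rfl <;> contradiction
  · rw [h.2 hc]

lemma ProperOn.singleton_mono (h : G.ProperOn {a} c)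
    (h' : ∀ e ∈ G.edgeSet, c' e = a → c e = a) : G.ProperOn {a} c' := by
  intro p q r hpq hpr hne ha heq
  have h1 := h' s(p, q) hpq (Finset.mem_singleton.1 ha)
  have h2 := h' s(p, r) hpr (heq ▸ Finset.mem_singleton.1 ha)
  exact h p q r hpq hpr hne (Finset.mem_singleton.2 h1) (h1.trans h2.symm)

lemma properOn_insert : G.ProperOn (insert a K) c ↔ G.ProperOn K c ∧ G.ProperOn {a} c := by
  constructor
  · exact fun h => ⟨fun p q r h1 h2 h3 h4 => h p q r h1 h2 h3 (by simp [h4]),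
      fun p q r h1 h2 h3 h4 => h p q r h1 h2 h3 (by simp_all)⟩
  · intro h p q r h1 h2 h3 h4
    rcases Finset.mem_insert.1 h4 with h4 | h4
    · exact h.2 p q r h1 h2 h3 (by simp [h4])
    · exact h.1 p q r h1 h2 h3 h4

lemma IsPartial.exists_isOptimal [Fintype V] (h : G.IsPartial K a b M c) :
    ∃ c', G.IsOptimal K a b M c' := by
  obtain ⟨c', hc', hmin⟩ := WellFounded.has_min
    (measure fun c : Sym2 V → ℕ => (G.colourClass c b).ncard).wf
    {c | G.IsPartial K a b M c} ⟨c, h⟩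
  exact ⟨c', hc', fun d hd => not_lt.1 (hmin d hd)⟩

lemma IsOptimal.not_absorbable [Fintype V] (h : G.IsOptimal K a b M c) (ha : a ∉ K) (hb : b ∉ K)
    (hMG : M ⊆ G.edgeSet) {x y : V} (hxy : G.Adj x y) (hc : c s(x, y) = b) (hM : s(x, y) ∉ M) :
    ¬ G.Absorbable K c x y := by
  rintro ⟨c', hp, hK, hrec⟩
  have hmono : ∀ γ ∉ K, ∀ e ∈ G.edgeSet, c' e = γ → c e = γ := by
    intro γ hγ e he hce
    have hne : e ≠ s(x, y) := by
      rintro rfl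
      exact hγ (hce ▸ hK)
    exact ((hrec e he hne).eq_iff hγ).1 hce
  have h' : G.IsPartial K a b M c' := by
    refine ⟨hp, h.proper_singleton.singleton_mono (hmono a ha), fun e he => ?_, fun e he => ?_⟩
    · by_cases hne : e = s(x, y)
      · exact Or.inl (hne ▸ hK)
      · have hr := hrec e he hne
        rw [hr.eq_iff ha, hr.eq_iff hb]
        exact (h.range e he).imp_left hr.1
    · rw [(hrec e (hMG he) (by rintro rfl; exact hM he)).eq_iff ha]
      exact h.eq_on e he
  have hsub : G.colourClass c' b ⊆ G.colourClass c b := fun e he =>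
    ⟨he.1, hmono b hb e he.1 he.2⟩
  exact (h.le c' h').not_gt (Set.ncard_lt_ncard ((Set.ssubset_iff_of_subset hsub).2
    ⟨s(x, y), ⟨hxy, hc⟩, fun he => hb (he.2 ▸ hK)⟩))

lemma IsShift.eq_iff {x y z : V} (h : G.IsShift K c c' x y z) (hyz : z ≠ y)
    (hz : c s(x, z) ∈ K) (ha : a ∉ K) {e : Sym2 V} (he : e ∈ G.edgeSet) :
    c' e = a ↔ (e = s(x, z) ∧ c s(x, y) = a) ∨ (e ≠ s(x, y) ∧ c e = a) := by
  have hne : s(x, z) ≠ s(x, y) := mt Sym2.congr_right.1 hyz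
  by_cases h1 : e = s(x, y)
  · subst h1
    have := h.first hyz.symm
    simp only [hne.symm, false_and, ne_eq, not_true, or_self, iff_false]
    rintro rfl
    contradiction
  by_cases h2 : e = s(x, z)
  · subst h2
    rw [h.last]
    simp only [true_and, ne_eq, h1, not_false_eq_true]
    refine ⟨Or.inl, fun h => h.resolve_right ?_⟩
    rintro rfl
    contradiction
  simp only [h2, false_and, ne_eq, h1, not_false_eq_true, true_and, false_or]
  by_cases hx : x ∈ e
  · obtain ⟨w, rfl⟩ := Sym2.mem_iff_exists.1 hx
    refine (h.rest w he ?_ ?_).eq_iff ha <;> rintro rfl <;> contradiction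
  · induction e with
    | _ p q =>
      simp only [Sym2.mem_iff, not_or] at hx
      rw [h.off p q (Ne.symm hx.1) (Ne.symm hx.2)]

lemma IsShift.mem {x y z : V} (h : G.IsShift K c c' x y z) (hyz : z ≠ y)
    (hz : c s(x, z) ∈ K) {e : Sym2 V} (he : e ∈ G.edgeSet) (hne : e ≠ s(x, z))
    (hc : c e ∈ K) : c' e ∈ K := by
  by_contra hK
  rcases (h.eq_iff hyz hz hK he).1 rfl with h1 | h1
  · exact hne h1.1
  · exact hK (h1.2 ▸ hc)

lemma IsOptimal.shift [Fintype V] (h : G.IsOptimal K a b M c) (ha : a ∉ K) (hb : b ∉ K)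
    (hMG : M ⊆ G.edgeSet) {x y z : V} (hs : G.IsShift K c c' x y z) (hyz : z ≠ y)
    (hxy : G.Adj x y) (hxz : G.Adj x z) (hc : c s(x, y) = b) (hM : s(x, y) ∉ M)
    (hz : ∀ w, G.Adj z w → c s(z, w) ∈ K) : G.IsOptimal K a b M c' := by
  have hzK : c s(x, z) ∈ K := by
    rw [Sym2.eq_swap]
    exact hz x hxz.symm
  have hiff : ∀ {γ : ℕ} (_ : γ ∉ K) {e : Sym2 V} (_ : e ∈ G.edgeSet), _ :=
    fun {γ} hγ {e} he => hs.eq_iff hyz hzK (a := γ) hγ he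
  have hside : ∀ p q r, G.Adj p q → G.Adj p r → q ≠ r → s(p, q) = s(x, z) → b = a →
      c' s(p, r) ≠ a := by
    rintro p q r hpq hpr hqr h1 hba h2
    subst hba
    rcases (hiff hb hpr).1 h2 with h3 | h3
    · exact hqr (Sym2.congr_right.1 (h1.trans h3.1.symm))
    · rcases Sym2.eq_iff.1 h1 with ⟨rfl, rfl⟩ | ⟨rfl, rfl⟩
      · refine h.proper_singleton p r y hpr hxy ?_ (by simp [h3.2]) (h3.2.trans hc.symm)
        rintro rfl
        exact h3.1 rfl
      · exact hb (h3.2 ▸ hz r hpr)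
  have hpa : G.ProperOn {a} c' := by
    intro p q r hpq hpr hqr h1 h2
    rw [Finset.mem_singleton] at h1
    rw [h1] at h2
    rcases (hiff ha hpq).1 h1 with h3 | h3
    · exact hside p q r hpq hpr hqr h3.1 (hc.symm.trans h3.2) h2.symm
    rcases (hiff ha hpr).1 h2.symm with h4 | h4
    · exact hside p r q hpr hpq hqr.symm h4.1 (hc.symm.trans h4.2) h1
    exact h.proper_singleton p q r hpq hpr hqr (by simp [h3.2]) (h3.2.trans h4.2.symm)
  refine ⟨⟨hs.proper, hpa, fun e he => ?_, fun e he => ?_⟩, fun d hd => le_trans (le_of_eq ?_)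
    (h.le d hd)⟩
  · by_cases he1 : e = s(x, z)
    · rw [he1, hs.last]
      exact Or.inr (Or.inr hc)
    by_cases he2 : e = s(x, y)
    · rw [he2]
      exact Or.inl (hs.first hyz.symm)
    rw [hiff ha he, hiff hb he]
    refine (h.range e he).imp (hs.mem hyz hzK he he1) (Or.imp ?_ ?_) <;>
      exact fun h => Or.inr ⟨he2, h⟩
  · rw [hiff ha (hMG he)]
    refine Or.inr ⟨?_, h.eq_on e he⟩
    rintro rfl
    exact hM he
  · have : G.colourClass c' b = insert s(x, z) (G.colourClass c b \ {s(x, y)}) := by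
      ext e
      simp only [colourClass, Set.mem_insert_iff, Set.mem_ofPred_eq, Set.mem_sdiff,
        Set.mem_singleton_iff]
      constructor
      · rintro ⟨h1, h2⟩
        rcases (hiff hb h1).1 h2 with h3 | h3
        · exact Or.inl h3.1
        · exact Or.inr ⟨⟨h1, h3.2⟩, h3.1⟩
      · rintro (rfl | ⟨⟨h1, h2⟩, h3⟩)
        · exact ⟨hxz, hs.last.trans hc⟩
        · exact ⟨h1, (hiff hb h1).2 (Or.inr ⟨h3, h2⟩)⟩
    rw [this, Set.ncard_exchange]
    · exact fun he => hb (he.2 ▸ hzK)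
    · exact ⟨hxy, hc⟩

/-- In an optimal colouring the colour `b` can be moved from `xy` to another edge at `x`. -/
lemma IsOptimal.exists_shift [Fintype V] [DecidableEq V] [DecidableRel G.Adj]
    (h : G.IsOptimal K a b M c) (hdeg : ∀ v, G.degree v ≤ K.card) (ha : a ∉ K) (hb : b ∉ K)
    (hMG : M ⊆ G.edgeSet) {x y : V} (hxy : G.Adj x y) (hc : c s(x, y) = b) (hM : s(x, y) ∉ M) :
    ∃ z c', z ≠ y ∧ G.Adj x z ∧ (∀ w, G.Adj z w → c s(z, w) ∈ K) ∧ G.IsShift K c c' x y z ∧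
      G.IsOptimal K a b M c' := by
  obtain ⟨z, c', hzy, hxz, hfull, hs⟩ := (absorbable_or_exists_shift h.proper hdeg hxy
    (hc ▸ hb)).resolve_left (h.not_absorbable ha hb hMG hxy hc hM)
  have hz : ∀ w, G.Adj z w → c s(z, w) ∈ K := fun w hw =>
    mem_of_forall_not_misses (hdeg z) hfull hw
  exact ⟨z, c', hzy, hxz, hz, hs, h.shift ha hb hMG hs hzy hxy hxz hc hM hz⟩

lemma IsOptimal.ne_of_ne [Fintype V] [DecidableEq V] [DecidableRel G.Adj]
    (h : G.IsOptimal K a b M c) (hdeg : ∀ v, G.degree v ≤ K.card) (ha : a ∉ K) (hb : b ∉ K)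
    (hab : a ≠ b) (hMG : M ⊆ G.edgeSet) {e : Sym2 V} (he : e ∈ G.edgeSet) : c e ≠ b := by
  intro hc
  induction e with | _ x y =>
  have hM : ∀ {c}, G.IsOptimal K a b M c → ∀ e, c e = b → e ∉ M := fun h e he heM =>
    hab ((h.eq_on e heM).symm.trans he)
  obtain ⟨z, c₁, hzy, hxz, hz, hs, h₁⟩ := h.exists_shift hdeg ha hb hMG he hc (hM h _ hc)
  have hc₁ : c₁ s(z, x) = b := by
    rw [Sym2.eq_swap, hs.last, hc]
  obtain ⟨t, c₂, htx, hzt, ht, hs', h₂⟩ :=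
    h₁.exists_shift hdeg ha hb hMG hxz.symm hc₁ (hM h₁ _ hc₁)
  have hc₂ : c₂ s(z, t) = b := by rw [hs'.last, hc₁]
  have htz : c₁ s(z, t) ∈ K := by
    rw [Sym2.eq_swap]
    exact ht z hzt.symm
  have hzw : ∀ w, G.Adj z w → w ≠ t → c₂ s(z, w) ∈ K := by
    intro w hw hwt
    by_cases hwx : w = x
    · subst hwx
      exact hs'.first htx.symm
    · refine hs'.mem htx htz hw (mt Sym2.congr_right.1 hwt) ?_
      rw [hs.off z w hxz.ne' hwx]
      exact hz w hw
  have htw : ∀ w, G.Adj t w → w ≠ z → c₂ s(t, w) ∈ K := by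
    intro w hw hwz
    rw [hs'.off t w hzt.ne' hwz]
    exact ht w hw
  let d := Function.update c₂ s(z, t) a
  have hdzt : d s(z, t) = a := Function.update_self ..
  have hd : ∀ e, e ≠ s(z, t) → d e = c₂ e := fun e he => Function.update_of_ne he ..
  have hside : ∀ p q r, G.Adj p q → G.Adj p r → q ≠ r → s(p, q) = s(z, t) →
      d s(p, r) ∈ K := by
    intro p q r hpq hpr hqr h1
    rw [hd _ (fun h => hqr (Sym2.congr_right.1 (h1.trans h.symm)))]
    rcases Sym2.eq_iff.1 h1 with ⟨rfl, rfl⟩ | ⟨rfl, rfl⟩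
    · exact hzw r hpr hqr.symm
    · exact htw r hpr hqr.symm
  have hprop : G.ProperOn (insert a K) d := by
    intro p q r hpq hpr hqr hK heq
    by_cases h1 : s(p, q) = s(z, t)
    · have := hside p q r hpq hpr hqr h1
      rw [← heq, h1, hdzt] at this
      exact ha this
    by_cases h2 : s(p, r) = s(z, t)
    · have := hside p r q hpr hpq hqr.symm h2
      rw [heq, h2, hdzt] at this
      exact ha this
    rw [hd _ h1] at hK heq
    rw [hd _ h2] at heq
    exact properOn_insert.2 ⟨h₂.proper, h₂.proper_singleton⟩ p q r hpq hpr hqr hK heq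
  have hpart : G.IsPartial K a b M d := by
    refine ⟨(properOn_insert.1 hprop).1, (properOn_insert.1 hprop).2, fun e he => ?_,
      fun e he => ?_⟩
    · by_cases h1 : e = s(z, t)
      · rw [h1, hdzt]
        exact Or.inr (Or.inl rfl)
      · rw [hd _ h1]
        exact h₂.range e he
    · rw [hd, h₂.eq_on e he]
      rintro rfl
      exact hM h₂ _ hc₂ he
  have hsub : G.colourClass d b ⊆ G.colourClass c₂ b := by
    refine fun e he => ⟨he.1, ?_⟩
    rw [← hd]
    · exact he.2
    · rintro rfl
      exact hab (hdzt.symm.trans he.2)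
  exact (h₂.le d hpart).not_gt (Set.ncard_lt_ncard ((Set.ssubset_iff_of_subset hsub).2
    ⟨s(z, t), ⟨hzt, hc₂⟩, fun he => hab (hdzt.symm.trans he.2)⟩))

/-- There is a proper colouring by `insert a K` with colour `a` on `M`, hence an optimal one. -/
lemma exists_isOptimal [Fintype V] [DecidableEq V] [DecidableRel G.Adj]
    (hdeg : ∀ v, G.degree v ≤ K.card) (ha : a ∉ K)
    (hMG : M ⊆ G.edgeSet) (hM : ∀ x y z, s(x, y) ∈ M → s(x, z) ∈ M → y = z) :
    ∃ c, G.IsOptimal K a a M c := by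
  classical
  obtain ⟨b, hb⟩ := Infinite.exists_notMem_finset (insert a K)
  rw [Finset.mem_insert, not_or] at hb
  have h0 : G.IsPartial K a b M (fun e => if e ∈ M then a else b) := by
    refine ⟨fun p q r _ _ _ h1 => absurd h1 ?_, fun p q r _ _ hqr h1 h2 => ?_, fun e he => ?_,
      fun e he => if_pos he⟩
    · split_ifs
      exacts [ha, hb.2]
    · rw [Finset.mem_singleton] at h1
      rw [h1] at h2
      have h3 : s(p, q) ∈ M := by
        by_contra h
        exact hb.1 (by rw [if_neg h] at h1; exact h1)
      have h4 : s(p, r) ∈ M := by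
        by_contra h
        exact hb.1 (by rw [if_neg h] at h2; exact h2.symm)
      exact hqr (hM p q r h3 h4)
    · right
      split_ifs <;> simp
  obtain ⟨c, hc⟩ := h0.exists_isOptimal
  refine IsPartial.exists_isOptimal (c := c) ⟨hc.proper, hc.proper_singleton, fun e he => ?_, hc.eq_on⟩
  rcases hc.range e he with h | h | h
  · exact Or.inl h
  · exact Or.inr (Or.inl h)
  · exact absurd h (hc.ne_of_ne hdeg ha hb.2 (Ne.symm hb.1) hMG he)

end Optimal

end SimpleGraph

namespace SimpleGraph

/-- Vertices at distance at most `k` from an endpoint of `e`. -/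
def ballAround {V : Type} (G : SimpleGraph V) (k : ℕ) (e : Sym2 V) : Set V :=
  {w | ∃ u ∈ e, ∃ p : G.Walk u w, p.length ≤ k}

/-- Vertices on the trails from `v` using colours `i` and `a` alternately, starting with `i`, whose
edges of colour `a` lead into `N`. The flag records whether the last edge does not have
colour `i`. -/
inductive Alternating {V : Type} (G : SimpleGraph V) (c : Sym2 V → ℕ) (a i : ℕ) (N : Set V)
    (v : V) : Bool → V → Prop
  | base : Alternating G c a i N v true v
  | leaf {x t : V} : Alternating G c a i N v true x → G.Adj x t → c s(x, t) = i →
      Alternating G c a i N v false t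
  | centre {t x : V} : Alternating G c a i N v false t → G.Adj t x → c s(t, x) = a → x ∈ N →
      Alternating G c a i N v true x

/-- Interchanging `a` and `i` near `e` recolours `e` from `a` to `i`. -/
def Switchable {V : Type} (G : SimpleGraph V) (a i : ℕ) (e : Sym2 V) (c : Sym2 V → ℕ) : Prop :=
  ∃ S ⊆ G.ballAround 3 e, (∀ w ∈ e, w ∈ S) ∧ G.KempeClosed c a i S

section Switch

variable {V : Type} {G : SimpleGraph V} {K : Finset ℕ} {c c' : Sym2 V → ℕ} {a i : ℕ}
  {M : Set (Sym2 V)}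

lemma mem_ballAround_of_mem {e : Sym2 V} {w : V} (h : w ∈ e) (k : ℕ) : w ∈ G.ballAround k e :=
  ⟨w, h, Walk.nil, by simp⟩

lemma ballAround_mono {e : Sym2 V} {j k : ℕ} (h : j ≤ k) : G.ballAround j e ⊆ G.ballAround k e :=
  fun _ ⟨u, hu, p, hp⟩ => ⟨u, hu, p, hp.trans h⟩

lemma mem_ballAround_succ {e : Sym2 V} {k : ℕ} {w x : V} (h : w ∈ G.ballAround k e)
    (hwx : G.Adj w x) : x ∈ G.ballAround (k + 1) e := by
  obtain ⟨u, hu, p, hp⟩ := h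
  exact ⟨u, hu, p.concat hwx, by simpa using hp⟩

lemma EdgeDistGe.notMem_ballAround {e f : Sym2 V} {d j k : ℕ} (h : G.EdgeDistGe e f d) {w : V}
    (hw : w ∈ G.ballAround j e) (hjk : j + k < d) : w ∉ G.ballAround k f := by
  obtain ⟨u, hu, p, hp⟩ := hw
  rintro ⟨u', hu', p', hp'⟩
  have := h u u' hu hu' (p.append p'.reverse)
  rw [Walk.length_append, Walk.length_reverse] at this
  omega

lemma IsPartial.eq_of_eq (h : G.IsPartial K a a M c) {p q r : V} (hpq : G.Adj p q)
    (hpr : G.Adj p r) (heq : c s(p, q) = c s(p, r)) : q = r := by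
  by_contra hne
  refine properOn_insert.2 ⟨h.proper, h.proper_singleton⟩ p q r hpq hpr hne ?_ heq
  have := h.range s(p, q) hpq
  rw [Finset.mem_insert]
  tauto

lemma notMem_of_adj {x t : V} {e : Sym2 V}
    (hdist : ∀ e ∈ M, ∀ f ∈ M, e ≠ f → G.EdgeDistGe e f 9) (he : e ∈ M)
    (hx : x ∈ G.ballAround 4 e) (hxe : x ∉ e) : s(x, t) ∉ M := by
  intro h
  have hne : e ≠ s(x, t) := by
    rintro rfl
    exact hxe (Sym2.mem_mk_left x t)
  exact (hdist e he _ h hne).notMem_ballAround (k := 4) hx (by norm_num)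
    (mem_ballAround_of_mem (Sym2.mem_mk_left x t) 4)

/-- Moving at most one edge of colour `a` makes the neighbour of `u` along colour `i` miss `a`. -/
lemma IsOptimal.exists_misses [Fintype V] [DecidableEq V] [DecidableRel G.Adj]
    (h : G.IsOptimal K a a M c) (hdeg : ∀ v, G.degree v ≤ K.card) (ha : a ∉ K) (hi : i ∈ K)
    (hMG : M ⊆ G.edgeSet) (hdist : ∀ e ∈ M, ∀ f ∈ M, e ≠ f → G.EdgeDistGe e f 9)
    {u v : V} (he : s(u, v) ∈ M) :
    ∃ c', G.IsOptimal K a a M c' ∧ (∀ p, G.Adj u p → c' s(u, p) = i → G.Misses c' p a) ∧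
      ∀ p q, p ∉ G.ballAround 4 s(u, v) → q ∉ G.ballAround 4 s(u, v) →
        c' s(p, q) = c s(p, q) := by
  have hia : i ≠ a := by
    rintro rfl
    contradiction
  by_cases hall : ∀ p, G.Adj u p → c s(u, p) = i → G.Misses c p a
  · exact ⟨c, h, hall, fun _ _ _ _ => rfl⟩
  simp only [Misses] at hall
  push Not at hall
  obtain ⟨p, hup, hpi, q, hpq, hqa⟩ := hall
  have huv := h.eq_on _ he
  have hpv : p ≠ v := by
    rintro rfl
    exact hia (hpi.symm.trans huv)
  have hqu : q ≠ u := by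
    rintro rfl
    rw [Sym2.eq_swap] at hqa
    exact hia (hpi.symm.trans hqa)
  have hp1 : p ∈ G.ballAround 1 s(u, v) :=
    mem_ballAround_succ (mem_ballAround_of_mem (Sym2.mem_mk_left u v) 0) hup
  have hq2 : q ∈ G.ballAround 2 s(u, v) := mem_ballAround_succ hp1 hpq
  have hpM : s(q, p) ∉ M := by
    rw [Sym2.eq_swap]
    refine notMem_of_adj hdist he (ballAround_mono (by norm_num) hp1) ?_
    simp [hup.ne', hpv]
  have hqpa : c s(q, p) = a := by rwa [Sym2.eq_swap]
  obtain ⟨z, c', hzp, hqz, hz, hs, h'⟩ := h.exists_shift hdeg ha ha hMG hpq.symm hqpa hpM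
  refine ⟨c', h', fun p' hup' hp'i => ?_, fun r s hr hs' => hs.off r s ?_ ?_⟩
  · have hup2 : c' s(u, p) = i := by
      rw [hs.off u p hqu.symm hpq.ne, hpi]
    obtain rfl := h'.eq_of_eq hup' hup (hp'i.trans hup2.symm)
    intro w hw hwa
    have hzK : c s(q, z) ∈ K := by
      rw [Sym2.eq_swap]
      exact hz q hqz.symm
    rcases (hs.eq_iff hzp hzK ha hw).1 hwa with ⟨h1, -⟩ | ⟨h1, h2⟩
    · have := h1 ▸ Sym2.mem_mk_left p' w
      rcases Sym2.mem_iff.1 this with h3 | h3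
      · exact hpq.ne h3
      · exact hzp h3.symm
    · obtain rfl := h.eq_of_eq hw hpq (h2.trans hqa.symm)
      exact h1 Sym2.eq_swap
  · rintro rfl
    exact hr (ballAround_mono (by norm_num) hq2)
  · rintro rfl
    exact hs' (ballAround_mono (by norm_num) hq2)

lemma Alternating.mem_ballAround {u v w : V} {flag : Bool}
    (h : G.Alternating c a i (G.ballAround 2 s(u, v)) v flag w) :
    w ∈ G.ballAround (if flag then 2 else 3) s(u, v) := by
  induction h with
  | base => exact mem_ballAround_of_mem (Sym2.mem_mk_right u v) _
  | leaf _ hxt _ ih => exact mem_ballAround_succ ih hxt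
  | centre _ _ _ hN _ => exact hN

/-- Moving at most one edge of colour `a` confines the component of `uv` to a ball. -/
lemma IsOptimal.exists_switchable_of_misses [Fintype V] [DecidableEq V] [DecidableRel G.Adj]
    (h : G.IsOptimal K a a M c) (hdeg : ∀ v, G.degree v ≤ K.card) (ha : a ∉ K) (hi : i ∈ K)
    (hMG : M ⊆ G.edgeSet) (hdist : ∀ e ∈ M, ∀ f ∈ M, e ≠ f → G.EdgeDistGe e f 9)
    {u v : V} (he : s(u, v) ∈ M)
    (hu : ∀ p, G.Adj u p → c s(u, p) = i → G.Misses c p a) :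
    ∃ c', G.IsOptimal K a a M c' ∧ G.Switchable a i s(u, v) c' ∧
      ∀ p q, p ∉ G.ballAround 4 s(u, v) → q ∉ G.ballAround 4 s(u, v) →
        c' s(p, q) = c s(p, q) := by
  have hia : i ≠ a := by
    rintro rfl
    contradiction
  have huv : G.Adj u v := hMG he
  have huva : c s(u, v) = a := h.eq_on _ he
  have hvua : c s(v, u) = a := by rwa [Sym2.eq_swap]
  obtain ⟨N, hN⟩ : ∃ N, N = G.ballAround 2 s(u, v) := ⟨_, rfl⟩
  obtain ⟨S, hS⟩ : ∃ S : Set V, S = {w | w = u ∨ (G.Adj u w ∧ c s(u, w) = i) ∨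
    ∃ flag, G.Alternating c a i N v flag w} := ⟨_, rfl⟩
  have huS : u ∈ S := by
    rw [hS]
    exact Or.inl rfl
  have hpS : ∀ {w}, G.Adj u w → c s(u, w) = i → w ∈ S := fun h1 h2 => by
    rw [hS]
    exact Or.inr (Or.inl ⟨h1, h2⟩)
  have hAS : ∀ {flag w}, G.Alternating c a i N v flag w → w ∈ S := fun h1 => by
    rw [hS]
    exact Or.inr (Or.inr ⟨_, h1⟩)
  have hSball : S ⊆ G.ballAround 3 s(u, v) := by
    intro w hw
    rw [hS] at hw
    rcases hw with rfl | ⟨h1, -⟩ | ⟨flag, h1⟩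
    · exact mem_ballAround_of_mem (Sym2.mem_mk_left w v) _
    · exact ballAround_mono (by norm_num)
        (mem_ballAround_succ (mem_ballAround_of_mem (Sym2.mem_mk_left u v) 0) h1)
    · rw [hN] at h1
      exact ballAround_mono (by split_ifs <;> norm_num) h1.mem_ballAround
  have heS : ∀ w ∈ s(u, v), w ∈ S := by
    intro w hw
    rcases Sym2.mem_iff.1 hw with rfl | rfl
    · exact huS
    · exact hAS Alternating.base
  have hviol : ∀ s ∈ S, ∀ y, G.Adj s y → (c s(s, y) = a ∨ c s(s, y) = i) → y ∉ S →
      G.Alternating c a i N v false s ∧ c s(s, y) = a ∧ y ∉ N := by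
    intro s hs y hsy hc hy
    rw [hS] at hs
    rcases hs with rfl | ⟨h1, h2⟩ | ⟨flag, hA⟩
    · rcases hc with hc | hc
      · obtain rfl := h.eq_of_eq hsy huv (hc.trans huva.symm)
        exact absurd (hAS Alternating.base) hy
      · exact absurd (hpS hsy hc) hy
    · rcases hc with hc | hc
      · exact absurd hc (hu s h1 h2 y hsy)
      · obtain rfl := h.eq_of_eq hsy h1.symm (hc.trans (by rw [Sym2.eq_swap, h2]))
        exact absurd huS hy
    · cases hA with
      | base =>
        rcases hc with hc | hc
        · obtain rfl := h.eq_of_eq hsy huv.symm (hc.trans hvua.symm)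
          exact absurd huS hy
        · exact absurd (hAS (Alternating.leaf Alternating.base hsy hc)) hy
      | leaf hA hxt hci =>
        rcases hc with hc | hc
        · exact ⟨hA.leaf hxt hci, hc, fun hyN =>
            hy (hAS ((hA.leaf hxt hci).centre hsy hc hyN))⟩
        · obtain rfl := h.eq_of_eq hsy hxt.symm (hc.trans (by rw [Sym2.eq_swap, hci]))
          exact absurd (hAS hA) hy
      | centre hA htx hca hxN =>
        rcases hc with hc | hc
        · obtain rfl := h.eq_of_eq hsy htx.symm (hc.trans (by rw [Sym2.eq_swap, hca]))
          exact absurd (hAS hA) hy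
        · exact absurd (hAS ((hA.centre htx hca hxN).leaf hsy hc)) hy
  have hleaf : ∀ {s}, G.Alternating c a i N v false s → ∃ w ∈ S, G.Adj s w ∧ c s(s, w) = i := by
    intro s hA
    cases hA with
    | leaf hA hxt hci => exact ⟨_, hAS hA, hxt.symm, by rw [Sym2.eq_swap, hci]⟩
  by_cases hclosed : G.KempeClosed c a i S
  · exact ⟨c, h, ⟨S, hSball, heS, hclosed⟩, fun _ _ _ _ => rfl⟩
  simp only [KempeClosed] at hclosed
  push Not at hclosed
  obtain ⟨t, htS, x, htx, htc, hxS⟩ := hclosed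
  obtain ⟨htA, hta, hxN⟩ := hviol t htS x htx htc hxS
  have hxta : c s(x, t) = a := by rwa [Sym2.eq_swap]
  have hx4 : x ∈ G.ballAround 4 s(u, v) := mem_ballAround_succ (hSball htS) htx
  obtain ⟨z, c', hzt, hxz, hz, hs, h'⟩ := h.exists_shift hdeg ha ha hMG htx.symm hxta
    (notMem_of_adj hdist he hx4 fun hxe => hxS (heS x hxe))
  have hzK : c s(x, z) ∈ K := by
    rw [Sym2.eq_swap]
    exact hz x hxz.symm
  obtain ⟨H, hH⟩ : ∃ H : SimpleGraph V, ∀ p q, H.Adj p q ↔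
      G.Adj p q ∧ (c s(p, q) = a ∨ c s(p, q) = i) ∧ p ∈ S ∧ q ∈ S :=
    ⟨⟨fun p q => G.Adj p q ∧ (c s(p, q) = a ∨ c s(p, q) = i) ∧ p ∈ S ∧ q ∈ S,
      ⟨fun p q h => ⟨h.1.symm, by rw [Sym2.eq_swap]; exact h.2.1, h.2.2.2, h.2.2.1⟩⟩,
      ⟨fun p h => G.loopless.irrefl p h.1⟩⟩, fun _ _ => Iff.rfl⟩
  have hreach : ∀ w ∈ S, H.Reachable u w := by
    have hAr : ∀ flag w, G.Alternating c a i N v flag w → H.Reachable u w := by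
      intro flag w hA
      induction hA with
      | base => exact Adj.reachable ((hH _ _).2 ⟨huv, Or.inl huva, huS, hAS Alternating.base⟩)
      | leaf hA hxt hci ih =>
        exact ih.trans (Adj.reachable ((hH _ _).2 ⟨hxt, Or.inr hci, hAS hA, hAS (hA.leaf hxt hci)⟩))
      | centre hA htx hca hxN ih =>
        exact ih.trans (Adj.reachable
          ((hH _ _).2 ⟨htx, Or.inl hca, hAS hA, hAS (hA.centre htx hca hxN)⟩))
    intro w hw
    have hw' := hw
    rw [hS] at hw'
    rcases hw' with rfl | ⟨h1, h2⟩ | ⟨flag, h1⟩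
    · exact Reachable.refl _
    · exact Adj.reachable ((hH _ _).2 ⟨h1, Or.inr h2, huS, hw⟩)
    · exact hAr flag w h1
  have hends : ∀ w, G.Misses c w a ∨ G.Misses c w i → ∃ γ, ∀ y, H.Adj w y → c s(w, y) = γ := by
    rintro w (hw | hw)
    · exact ⟨i, fun y hy => (((hH _ _).1 hy).2.1).resolve_left (hw y ((hH _ _).1 hy).1)⟩
    · exact ⟨a, fun y hy => (((hH _ _).1 hy).2.1).resolve_right (hw y ((hH _ _).1 hy).1)⟩
  have hvend : ∀ s ∈ S, ∀ y, G.Adj s y → c s(s, y) = a → y ∉ S →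
      ∃ γ, ∀ y, H.Adj s y → c s(s, y) = γ := by
    intro s hs y hsy hc hy
    refine ⟨i, fun w hw => ?_⟩
    obtain ⟨h1, h2, -, h4⟩ := (hH _ _).1 hw
    refine h2.resolve_left fun h5 => ?_
    obtain rfl := h.eq_of_eq hsy h1 (hc.trans h5.symm)
    exact hy h4
  obtain ⟨r, hrS, hr1, hr⟩ : ∃ r ∈ S, r ∈ G.ballAround 1 s(u, v) ∧
      (G.Misses c r a ∨ G.Misses c r i) := by
    by_cases hmu : G.Misses c u i
    · exact ⟨u, huS, mem_ballAround_of_mem (Sym2.mem_mk_left u v) _, Or.inr hmu⟩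
    · simp only [Misses] at hmu
      push Not at hmu
      obtain ⟨p, hup, hpi⟩ := hmu
      exact ⟨p, hpS hup hpi, mem_ballAround_succ
        (mem_ballAround_of_mem (Sym2.mem_mk_left u v) 0) hup, Or.inl (hu p hup hpi)⟩
  have hthree : ∀ {p q}, p ∈ S → q ∈ S → p ≠ q → p ≠ r → q ≠ r →
      (∃ γ, ∀ y, H.Adj p y → c s(p, y) = γ) → (∃ γ, ∀ y, H.Adj q y → c s(q, y) = γ) → False := by
    intro p q hp hq hpq hpr hqr hpe hqe
    refine not_reachable_of_three_ends (α := a) (β := i) H (fun v w hvw => ((hH _ _).1 hvw).2.1)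
      (fun p q r hpq hpr heq => h.eq_of_eq ((hH _ _).1 hpq).1 ((hH _ _).1 hpr).1 heq)
      hpq hpr hqr hpe hqe (hends r hr) ?_ ?_
    · exact (hreach p hp).symm.trans (hreach q hq)
    · exact (hreach p hp).symm.trans (hreach r hrS)
  have hvr : ∀ s, G.Alternating c a i N v false s → ∀ y, G.Adj s y → c s(s, y) = a → s ≠ r := by
    rintro s hA y hsy hc rfl
    obtain ⟨w, -, hsw, hw⟩ := hleaf hA
    rcases hr with hr | hr
    · exact hr y hsy hc
    · exact hr w hsw hw
  have hxr : ∀ w, G.Adj x w → w ≠ r := by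
    rintro w hxw rfl
    rw [hN] at hxN
    exact hxN (mem_ballAround_succ hr1 hxw.symm)
  have htr := hvr t htA x htx hta
  have htend := hvend t htS x htx hta hxS
  refine ⟨c', h', ⟨S, hSball, heS, ?_⟩, fun p q hp hq => hs.off p q ?_ ?_⟩
  · intro s hsS y hsy hc
    by_contra hy
    have hsx : s ≠ x := by
      rintro rfl
      contradiction
    by_cases hyx : y = x
    · subst hyx
      rcases hc with hc | hc
      · rcases (hs.eq_iff hzt hzK ha hsy).1 hc with ⟨h1, -⟩ | ⟨h1, h2⟩
        · obtain rfl : s = z := by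
            rw [Sym2.eq_swap] at h1
            exact Sym2.congr_right.1 h1
          refine hthree htS hsS hzt.symm htr (hxr s hxz) htend (hends s (Or.inl ?_))
          exact fun w hw hwa => ha (hwa ▸ hz w hw)
        · rw [Sym2.eq_swap] at h1 h2
          obtain rfl := h.eq_of_eq hsy.symm htx.symm (h2.trans hxta.symm)
          exact h1 rfl
      · have hmiss : G.Misses c s i := by
          intro w hsw hw
          by_cases hwy : w = y
          · subst hwy
            exact hia (hw.symm.trans (hviol s hsS w hsy (Or.inr hw) hy).2.1)
          · refine hwy (h'.eq_of_eq hsw hsy ?_)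
            rw [hs.off s w hsx hwy, hw, hc]
        have hts : t ≠ s := by
          rintro rfl
          obtain ⟨w, -, hsw, hw⟩ := hleaf htA
          exact hmiss w hsw hw
        exact hthree htS hsS hts htr (hxr s hsy.symm) htend (hends s (Or.inr hmiss))
    · rw [hs.off s y hsx hyx] at hc
      obtain ⟨hsA, hsa, -⟩ := hviol s hsS y hsy hc hy
      have hts : t ≠ s := by
        rintro rfl
        exact hyx (h.eq_of_eq hsy htx (hsa.trans hta.symm))
      exact hthree htS hsS hts htr (hvr s hsA y hsy hsa) htend (hvend s hsS y hsy hsa hy)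
  · rintro rfl
    exact hp hx4
  · rintro rfl
    exact hq hx4

lemma IsOptimal.exists_switchable [Fintype V] [DecidableEq V] [DecidableRel G.Adj]
    (h : G.IsOptimal K a a M c) (hdeg : ∀ v, G.degree v ≤ K.card) (ha : a ∉ K)
    (hi : i ∈ insert a K)
    (hMG : M ⊆ G.edgeSet) (hdist : ∀ e ∈ M, ∀ f ∈ M, e ≠ f → G.EdgeDistGe e f 9)
    {e : Sym2 V} (he : e ∈ M) :
    ∃ c', G.IsOptimal K a a M c' ∧ G.Switchable a i e c' ∧
      ∀ p q, p ∉ G.ballAround 4 e → q ∉ G.ballAround 4 e → c' s(p, q) = c s(p, q) := by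
  induction e with | _ u v =>
  rcases Finset.mem_insert.1 hi with rfl | hi
  · refine ⟨c, h, ⟨{w | w ∈ s(u, v)}, fun w hw => mem_ballAround_of_mem hw _, fun w hw => hw, ?_⟩,
      fun _ _ _ _ => rfl⟩
    intro p hp q hpq hc
    rw [or_self] at hc
    obtain ⟨w, hw⟩ := Sym2.mem_iff_exists.1 hp
    have huv : G.Adj p w := by
      rw [← mem_edgeSet, ← hw]
      exact hMG he
    have hcw : c s(p, w) = i := hw ▸ h.eq_on _ he
    obtain rfl := h.eq_of_eq hpq huv (hc.trans hcw.symm)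
    show q ∈ s(u, v)
    rw [hw]
    exact Sym2.mem_mk_right p q
  · obtain ⟨c₁, h₁, hu, hoff₁⟩ := h.exists_misses hdeg ha hi hMG hdist he
    obtain ⟨c₂, h₂, hsw, hoff₂⟩ := h₁.exists_switchable_of_misses hdeg ha hi hMG hdist he hu
    exact ⟨c₂, h₂, hsw, fun p q hp hq => (hoff₂ p q hp hq).trans (hoff₁ p q hp hq)⟩

lemma Switchable.congr {e : Sym2 V} (h : G.Switchable a i e c)
    (h' : ∀ p q, p ∈ G.ballAround 3 e → q ∈ G.ballAround 4 e → c' s(p, q) = c s(p, q)) :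
    G.Switchable a i e c' := by
  obtain ⟨S, hS, heS, hcl⟩ := h
  refine ⟨S, hS, heS, fun p hp q hpq hc => hcl p hp q hpq ?_⟩
  rwa [h' p q (hS hp) (mem_ballAround_succ (hS hp) hpq)] at hc

lemma exists_isOptimal_switchable [Fintype V] [DecidableEq V] [DecidableRel G.Adj]
    (hdeg : ∀ v, G.degree v ≤ K.card) (ha : a ∉ K) {Φ : Sym2 V → ℕ}
    (hMG : M ⊆ G.edgeSet) (hM : ∀ x y z, s(x, y) ∈ M → s(x, z) ∈ M → y = z)
    (hdist : ∀ e ∈ M, ∀ f ∈ M, e ≠ f → G.EdgeDistGe e f 9)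
    (hΦ : ∀ e ∈ M, Φ e ∈ insert a K) (T : Finset (Sym2 V)) (hT : ∀ e ∈ T, e ∈ M) :
    ∃ c, G.IsOptimal K a a M c ∧ ∀ e ∈ T, G.Switchable a (Φ e) e c := by
  induction T using Finset.induction_on with
  | empty =>
    obtain ⟨c, hc⟩ := exists_isOptimal hdeg ha hMG hM
    exact ⟨c, hc, by simp⟩
  | insert e T heT ih =>
    obtain ⟨c, hc, hsw⟩ := ih fun f hf => hT f (Finset.mem_insert_of_mem hf)
    have he := hT e (Finset.mem_insert_self e T)
    obtain ⟨c', hc', hsw', hoff⟩ := hc.exists_switchable hdeg ha (hΦ e he) hMG hdist he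
    refine ⟨c', hc', fun f hf => ?_⟩
    rcases Finset.mem_insert.1 hf with rfl | hfT
    · exact hsw'
    · have hd := hdist f (hT f hf) e he (by rintro rfl; contradiction)
      refine (hsw f hfT).congr fun p q hp hq => hoff p q ?_ ?_
      · exact hd.notMem_ballAround hp (by norm_num)
      · exact hd.notMem_ballAround hq (by norm_num)

lemma exists_properOn_eq [Fintype V] [DecidableEq V] [DecidableRel G.Adj]
    (hdeg : ∀ v, G.degree v ≤ K.card) (ha : a ∉ K) {Φ : Sym2 V → ℕ}
    (hMG : M ⊆ G.edgeSet) (hM : ∀ x y z, s(x, y) ∈ M → s(x, z) ∈ M → y = z)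
    (hdist : ∀ e ∈ M, ∀ f ∈ M, e ≠ f → G.EdgeDistGe e f 9)
    (hΦ : ∀ e ∈ M, Φ e ∈ insert a K) (R T : Finset (Sym2 V)) (hR : ∀ e ∈ R, e ∈ M)
    (hT : T ⊆ R) :
    ∃ c, G.ProperOn (insert a K) c ∧ (∀ e ∈ G.edgeSet, c e ∈ insert a K) ∧
      (∀ e ∈ T, c e = Φ e) ∧ ∀ e ∈ R, e ∉ T → c e = a ∧ G.Switchable a (Φ e) e c := by
  induction T using Finset.induction_on with
  | empty =>
    obtain ⟨c, hc, hsw⟩ := exists_isOptimal_switchable hdeg ha hMG hM hdist hΦ R hR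
    refine ⟨c, properOn_insert.2 ⟨hc.proper, hc.proper_singleton⟩, fun e he => ?_, by simp,
      fun e he _ => ⟨hc.eq_on e (hR e he), hsw e he⟩⟩
    have := hc.range e he
    rw [Finset.mem_insert]
    tauto
  | insert e T heT ih =>
    obtain ⟨c, hp, hr, hcT, hcR⟩ := ih fun f hf => hT (Finset.mem_insert_of_mem hf)
    have heR := hT (Finset.mem_insert_self e T)
    have hΦe := hΦ e (hR e heR)
    have haK := Finset.mem_insert_self a K
    obtain ⟨hea, S, hS, heS, hcl⟩ := hcR e heR heT
    have hsame : ∀ f ∈ R, f ≠ e → ∀ p q, p ∈ G.ballAround 3 f → q ∈ G.ballAround 4 f →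
        kempeSwap c a (Φ e) S s(p, q) = c s(p, q) := by
      intro f hf hfe p q hpf hqf
      have hd := hdist f (hR f hf) e (hR e heR) hfe
      refine if_neg ?_
      rintro ⟨w, hw, hwe⟩
      rcases Sym2.mem_iff.1 hwe with rfl | rfl
      · exact hd.notMem_ballAround hpf (by norm_num) (hS hw)
      · exact hd.notMem_ballAround hqf (by norm_num) (hS hw)
    have hsame' : ∀ f ∈ R, f ≠ e → kempeSwap c a (Φ e) S f = c f := by
      intro f hf hfe
      induction f with
      | _ p q =>
        exact hsame _ hf hfe p q (mem_ballAround_of_mem (Sym2.mem_mk_left p q) _)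
          (mem_ballAround_of_mem (Sym2.mem_mk_right p q) _)
    refine ⟨kempeSwap c a (Φ e) S, hp.kempeSwap haK hΦe hcl, fun f hf =>
      (kempeSwap_recolouredWithin haK hΦe f).1 (hr f hf), fun f hf => ?_, fun f hfR hf => ?_⟩
    · rcases Finset.mem_insert.1 hf with rfl | hfT
      · induction f with
        | _ p q =>
          rw [kempeSwap_of_mem (heS p (Sym2.mem_mk_left p q)), hea, Equiv.swap_apply_left]
      · rw [hsame' f (hT hf) (by rintro rfl; contradiction)]
        exact hcT f hfT
    · rw [Finset.mem_insert, not_or] at hf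
      obtain ⟨h1, h2⟩ := hcR f hfR hf.2
      exact ⟨(hsame' f hfR hf.1).trans h1, h2.congr (hsame f hfR hf.1)⟩

end Switch

end SimpleGraph

/-- Simple-graph case of the main theorem: any precolouring from
`{1, …, Δ + 1}` of a matching whose edges are pairwise at distance at least `9`
extends to a proper `(Δ + 1)`-edge-colouring. -/
theorem precolouring_extension_simple {V : Type} [Fintype V] [DecidableEq V]
    (G : SimpleGraph V) [DecidableRel G.Adj] (Δ : ℕ) (hΔ : ∀ v, G.degree v ≤ Δ)
    (M : Set (Sym2 V)) (hM : G.IsMatchingSet M)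
    (hdist : ∀ e ∈ M, ∀ f ∈ M, e ≠ f → G.EdgeDistGe e f 9)
    (Φ : Sym2 V → ℕ) (hΦ : ∀ e ∈ M, Φ e ∈ Finset.Icc 1 (Δ + 1)) :
    ∃ c : Sym2 V → ℕ, G.IsProperEC ∅ (Δ + 1) c ∧ ∀ e ∈ M, c e = Φ e := by
  have hK : Finset.Icc 1 (Δ + 1) = insert (Δ + 1) (Finset.Icc 1 Δ) := by
    ext n
    simp only [Finset.mem_insert, Finset.mem_Icc]
    omega
  have hM' : ∀ x y z, s(x, y) ∈ M → s(x, z) ∈ M → y = z := by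
    intro x y z hy hz
    by_contra hne
    have hne' : s(x, y) ≠ s(x, z) := mt Sym2.congr_right.1 hne
    exact hM.2 _ hy _ hz hne' ⟨hne', x, Sym2.mem_mk_left x y, Sym2.mem_mk_left x z⟩
  rw [hK] at hΦ
  obtain ⟨c, hp, hr, hc, -⟩ := exists_properOn_eq (K := Finset.Icc 1 Δ) (by simpa using hΔ)
    (by simp) hM.1 hM' hdist hΦ M.toFinite.toFinset M.toFinite.toFinset (by simp) subset_rfl
  refine ⟨c, ⟨fun e he _ => hK ▸ hr e he, ?_⟩, fun e he => hc e (by simpa using he)⟩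
  rintro e he f hf - - ⟨hne, v, hve, hvf⟩
  obtain ⟨w, rfl⟩ := Sym2.mem_iff_exists.1 hve
  obtain ⟨w', rfl⟩ := Sym2.mem_iff_exists.1 hvf
  exact hp v w w' he hf (mt Sym2.congr_right.2 hne) (hr _ he)
end

section
/- There exists a simple graph G with maximum degree Δ (for some Δ ≥ 2) and a matching M of G whose edges are pairwise at distance at least 1, together with a precolouring of M from the palette {1, …, Δ + 1}, such that no proper (Δ + 1)-edge-colouring of G agrees with the precolouring on M. -/
open SimpleGraph

namespace SimpleGraph

/-- A bipartite graph between `{0, 1, 2, 3}` and `{4, 5, 6, 7}` (complete except for the pairs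
`04` and `15`), a vertex `8` joined to `0, 1, 4, 5`, a vertex `9`, and the perfect matching
`01, 23, 45, 67, 89`. -/
def matchedGraph : SimpleGraph (Fin 10) :=
  fromRel fun i j =>
    (i < 4 ∧ 4 ≤ j ∧ j < 8 ∧ ¬ (i = 0 ∧ j = 4) ∧ ¬ (i = 1 ∧ j = 5)) ∨
    (j = 8 ∧ (i = 0 ∨ i = 1 ∨ i = 4 ∨ i = 5)) ∨
    (i = 0 ∧ j = 1) ∨ (i = 2 ∧ j = 3) ∨ (i = 4 ∧ j = 5) ∨ (i = 6 ∧ j = 7) ∨ (i = 8 ∧ j = 9)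

instance : DecidableRel matchedGraph.Adj := fun _ _ =>
  inferInstanceAs (Decidable (_ ∧ (_ ∨ _)))

/-- The perfect matching of `matchedGraph`. -/
def matchedEdges : Finset (Sym2 (Fin 10)) :=
  {s(0, 1), s(2, 3), s(4, 5), s(6, 7), s(8, 9)}

/-- The precolouring of `matchedEdges`. -/
def matchedColouring (e : Sym2 (Fin 10)) : ℕ :=
  if e = s(0, 1) ∨ e = s(2, 3) then 1 else 2

/-- The partner of a vertex in `matchedEdges`. -/
def matchedPartner : Fin 10 → Fin 10 := ![1, 0, 3, 2, 5, 4, 7, 6, 9, 8]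

theorem IsProperEC.apply_ne {V : Type} {G : SimpleGraph V} {k : ℕ} {c : Sym2 V → ℕ}
    (hc : G.IsProperEC ∅ k c) {x y z : V} (hy : G.Adj x y) (hz : G.Adj x z) (hyz : y ≠ z) :
    c s(x, y) ≠ c s(x, z) :=
  hc.2 _ hy _ hz (Set.notMem_empty _) (Set.notMem_empty _)
    ⟨fun h => hyz (Sym2.congr_right.1 h), x, Sym2.mem_mk_left x y, Sym2.mem_mk_left x z⟩

theorem edgeDistGe_one {V : Type} (G : SimpleGraph V) {e f : Sym2 V} (hef : e ≠ f)
    (h : ¬ EdgeAdj e f) : G.EdgeDistGe e f 1 := by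
  intro u v hu hv p
  by_contra hp
  obtain rfl := Walk.eq_of_length_eq_zero (p := p) (by omega)
  exact h ⟨hef, u, hu, hv⟩

theorem matchedGraph_isMatchingSet :
    matchedGraph.IsMatchingSet (matchedEdges : Set (Sym2 (Fin 10))) := by
  constructor
  · have h : ∀ e ∈ matchedEdges, e ∈ matchedGraph.edgeSet := by decide
    exact h
  · have h : ∀ e ∈ matchedEdges, ∀ v ∈ e, e = s(v, matchedPartner v) := by decide
    rintro e he f hf hef ⟨-, v, hve, hvf⟩
    exact hef ((h e he v hve).trans (h f hf v hvf).symm)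

theorem ncard_neighborSet_matchedGraph (v : Fin 10) :
    (matchedGraph.neighborSet v).ncard = matchedGraph.degree v := by
  rw [Set.ncard_eq_toFinset_card', ← card_neighborFinset_eq_degree, neighborFinset]

section Colouring

variable {c : Sym2 (Fin 10) → ℕ}

/-- An edge outside the matching avoids the colour of a matching edge it meets. -/
theorem ne_matchedColouring (hc : matchedGraph.IsProperEC ∅ 6 c)
    (hM : ∀ e ∈ matchedEdges, c e = matchedColouring e) {x y : Fin 10} (hxy : matchedGraph.Adj x y)
    (hy : y ≠ matchedPartner x) : c s(x, y) ≠ matchedColouring s(x, matchedPartner x) := by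
  have hx : ∀ x, s(x, matchedPartner x) ∈ matchedEdges := by decide
  rw [← hM _ (hx x)]
  exact hc.apply_ne hxy (matchedGraph_isMatchingSet.1 (hx x)) hy

/-- The edges between `{0, 1, 2, 3}` and its complement use only the colours `3, 4, 5, 6`. -/
theorem colour_mem_Icc (hc : matchedGraph.IsProperEC ∅ 6 c)
    (hM : ∀ e ∈ matchedEdges, c e = matchedColouring e) {x y : Fin 10}
    (hxy : matchedGraph.Adj x y) (hx : x < 4) (hy : 4 ≤ y) :
    c s(x, y) ∈ Finset.Icc 3 6 := by
  have h : ∀ x y : Fin 10, x < 4 → 4 ≤ y → y ≠ matchedPartner x ∧ x ≠ matchedPartner y ∧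
      matchedColouring s(x, matchedPartner x) = 1 ∧
      matchedColouring s(y, matchedPartner y) = 2 := by decide
  obtain ⟨hyx, hxy', h1, h2⟩ := h x y hx hy
  have h3 := ne_matchedColouring hc hM hxy hyx
  have h4 := ne_matchedColouring hc hM hxy.symm hxy'
  have h5 := Finset.mem_Icc.1 (hc.1 _ ((mem_edgeSet _).2 hxy) (Set.notMem_empty _))
  rw [Sym2.eq_swap] at h4
  rw [Finset.mem_Icc]
  omega

/-- Each of the colours `3, 4, 5, 6` appears at each of the vertices `0, 1, 2, 3`. -/
theorem exists_adj_colour_eq (hc : matchedGraph.IsProperEC ∅ 6 c)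
    (hM : ∀ e ∈ matchedEdges, c e = matchedColouring e) {x : Fin 10}
    (hx : x < 4) {a : ℕ} (ha : a ∈ Finset.Icc 3 6) :
    ∃ y, 4 ≤ y ∧ matchedGraph.Adj x y ∧ c s(x, y) = a := by
  let N : Finset (Fin 10) := {y | 4 ≤ y ∧ matchedGraph.Adj x y}
  have hN : ∀ y ∈ N, 4 ≤ y ∧ matchedGraph.Adj x y := fun y hy => by simpa [N] using hy
  have hcard : ∀ x : Fin 10, x < 4 →
      (Finset.univ.filter fun y => 4 ≤ y ∧ matchedGraph.Adj x y).card = 4 := by decide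
  have hinj : Set.InjOn (fun y => c s(x, y)) N := by
    intro y hy z hz hyz
    by_contra hne
    exact hc.apply_ne (hN y hy).2 (hN z hz).2 hne hyz
  have himage : N.image (fun y => c s(x, y)) = Finset.Icc 3 6 := by
    refine Finset.eq_of_subset_of_card_le ?_ ?_
    · intro b hb
      obtain ⟨y, hy, rfl⟩ := Finset.mem_image.1 hb
      exact colour_mem_Icc hc hM (hN y hy).2 hx (hN y hy).1
    · rw [Finset.card_image_of_injOn hinj, hcard x hx]
      decide
  rw [← himage] at ha
  obtain ⟨y, hy, rfl⟩ := Finset.mem_image.1 ha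
  exact ⟨y, (hN y hy).1, (hN y hy).2, rfl⟩

/-- If the edge from `8` to `4` or `5` had a colour in `{3, 4, 5, 6}`, the four edges of that
colour at `0, 1, 2, 3` would have only three vertices left for their other endpoints. -/
theorem colour_eq_one (hc : matchedGraph.IsProperEC ∅ 6 c)
    (hM : ∀ e ∈ matchedEdges, c e = matchedColouring e) {r : Fin 10}
    (hr : r = 4 ∨ r = 5) : c s(8, r) = 1 := by
  have hadj : ∀ r : Fin 10, r = 4 ∨ r = 5 → matchedGraph.Adj 8 r ∧ r ≠ matchedPartner 8 := by
    decide
  have h2 : c s(8, r) ≠ 2 := ne_matchedColouring hc hM (hadj r hr).1 (hadj r hr).2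
  have hrange := Finset.mem_Icc.1 (hc.1 _ ((mem_edgeSet _).2 (hadj r hr).1) (Set.notMem_empty _))
  by_contra h1
  have ha : c s(8, r) ∈ Finset.Icc 3 6 := Finset.mem_Icc.2 (by omega)
  choose! g hg using fun (x : Fin 10) (hx : x < 4) => exists_adj_colour_eq hc hM hx ha
  have hmaps : Set.MapsTo g (Finset.Iio (4 : Fin 10)) ((Finset.Ico (4 : Fin 10) 8).erase r) := by
    intro x hx
    have hx4 : x < 4 := by simpa using hx
    obtain ⟨h4, hxg, hcol⟩ := hg x hx4
    have hne : ∀ x r : Fin 10, x < 4 → r = 4 ∨ r = 5 → x ≠ r ∧ x ≠ 8 := by decide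
    obtain ⟨hxr, hx8⟩ := hne x r hx4 hr
    have hgr : g x ≠ r := by
      intro h
      rw [h] at hxg hcol
      refine hc.apply_ne hxg.symm (hadj r hr).1.symm hx8 ?_
      rw [Sym2.eq_swap, hcol, Sym2.eq_swap]
    have hg8 : g x ≠ 8 := by
      intro h
      rw [h] at hxg hcol
      refine hc.apply_ne hxg.symm (hadj r hr).1 hxr ?_
      rw [Sym2.eq_swap, hcol]
    have hlt : ∀ x y : Fin 10, x < 4 → matchedGraph.Adj x y → y ≠ 8 → y < 8 := by decide
    simpa [hgr, h4] using hlt x _ hx4 hxg hg8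
  have hcard : ∀ r : Fin 10, r = 4 ∨ r = 5 →
      ((Finset.Ico (4 : Fin 10) 8).erase r).card < (Finset.Iio (4 : Fin 10)).card := by decide
  obtain ⟨x, hx, y, hy, hxy, hgxy⟩ :=
    Finset.exists_ne_map_eq_of_card_lt_of_maps_to (hcard r hr) hmaps
  obtain ⟨-, hxg, hcx⟩ := hg x (by simpa using hx)
  obtain ⟨-, hyg, hcy⟩ := hg y (by simpa using hy)
  rw [← hgxy] at hyg hcy
  refine hc.apply_ne hxg.symm hyg.symm hxy ?_
  rw [Sym2.eq_swap, hcx, ← hcy, Sym2.eq_swap]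

end Colouring

end SimpleGraph

/-- There is a simple graph with maximum degree `Δ ≥ 2`, a matching whose edges
are pairwise at distance at least `1`, and a precolouring from `{1, …, Δ + 1}`
that does not extend to a proper `(Δ + 1)`-edge-colouring. -/
theorem precolouring_distance_one_fails :
    ∃ (n Δ : ℕ) (G : SimpleGraph (Fin n)) (M : Set (Sym2 (Fin n))) (Φ : Sym2 (Fin n) → ℕ),
      2 ≤ Δ ∧ (∀ v, (G.neighborSet v).ncard ≤ Δ) ∧ (∃ v, (G.neighborSet v).ncard = Δ) ∧
      G.IsMatchingSet M ∧
      (∀ e ∈ M, ∀ f ∈ M, e ≠ f → G.EdgeDistGe e f 1) ∧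
      (∀ e ∈ M, Φ e ∈ Finset.Icc 1 (Δ + 1)) ∧
      ¬ ∃ c : Sym2 (Fin n) → ℕ, G.IsProperEC ∅ (Δ + 1) c ∧ ∀ e ∈ M, c e = Φ e := by
  have hmatch := matchedGraph_isMatchingSet
  refine ⟨10, 5, matchedGraph, matchedEdges, matchedColouring, by norm_num, ?_, ⟨0, ?_⟩, hmatch,
    fun e he f hf hef => edgeDistGe_one _ hef (hmatch.2 e he f hf hef), ?_, ?_⟩
  · have h : ∀ v, matchedGraph.degree v ≤ 5 := by decide
    exact fun v => (ncard_neighborSet_matchedGraph v).trans_le (h v)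
  · rw [ncard_neighborSet_matchedGraph]
    decide
  · have h : ∀ e ∈ matchedEdges, matchedColouring e ∈ Finset.Icc 1 (5 + 1) := by decide
    exact h
  · rintro ⟨c, hc, hM⟩
    have h4 : matchedGraph.Adj 8 4 := by decide
    have h5 : matchedGraph.Adj 8 5 := by decide
    refine hc.apply_ne h4 h5 (by decide) ?_
    rw [colour_eq_one hc hM (Or.inl rfl), colour_eq_one hc hM (Or.inr rfl)]
end
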